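/- arXiv:1703.06220 — 9 statements merged into one kernel-verified Lean document; each statement's English description precedes it below -/
import Mathlib

section
/- Let H and K be complex Hilbert spaces, D a linear subspace of H, and let T : D → H and Γ₁, Γ₀ : D → K be linear maps satisfying Green's formula ⟨Tf,g⟩_H − ⟨f,Tg⟩_H = ⟨Γ₁f,Γ₀g⟩_K − ⟨Γ₀f,Γ₁g⟩_K for all f,g ∈ D, and such that the map f ↦ (Γ₁f, Γ₀f) from D to K ⊕ K is surjective. Let B be a bounded linear operator on K and set D_B := {f ∈ D : Γ₁f = BΓ₀f}. Then Im⟨Tf,f⟩ ≥ 0 for all f ∈ D_B if and only if Im⟨Bk,k⟩ ≥ 0 for all k ∈ K. -/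
open scoped InnerProductSpace

/-- **Dissipativity criterion for almost solvable extensions.**
Given maps `T, Γ₁, Γ₀` on a subspace `D` of a complex Hilbert space `H` satisfying
Green's formula (with inner products antilinear in the second argument, i.e.
the paper's `⟨x, y⟩` is Mathlib's `⟪y, x⟫_ℂ`) and the boundary-triple surjectivity
condition, and a bounded operator `B` on `K`, the restriction of `T` to
`{f ∈ D : Γ₁ f = B Γ₀ f}` is dissipative iff `B` is dissipative. -/
theorem dissipative_iff_boundary_param_dissipative
    {H K : Type*}
    [NormedAddCommGroup H] [InnerProductSpace ℂ H] [CompleteSpace H]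
    [NormedAddCommGroup K] [InnerProductSpace ℂ K] [CompleteSpace K]
    (D : Submodule ℂ H) (T : D →ₗ[ℂ] H) (Γ₁ Γ₀ : D →ₗ[ℂ] K)
    (green : ∀ f g : D,
      ⟪(g : H), T f⟫_ℂ - ⟪T g, (f : H)⟫_ℂ = ⟪Γ₀ g, Γ₁ f⟫_ℂ - ⟪Γ₁ g, Γ₀ f⟫_ℂ)
    (surj : Function.Surjective (fun f : D => (Γ₁ f, Γ₀ f)))
    (B : K →L[ℂ] K) :
    (∀ f : D, Γ₁ f = B (Γ₀ f) → 0 ≤ (⟪(f : H), T f⟫_ℂ).im) ↔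
      (∀ k : K, 0 ≤ (⟪k, B k⟫_ℂ).im) := by
  have key : ∀ f : D, (⟪(f : H), T f⟫_ℂ).im = (⟪Γ₀ f, Γ₁ f⟫_ℂ).im := fun f => by
    have h := congrArg Complex.im (green f f)
    rw [← inner_conj_symm (T f) (f : H), ← inner_conj_symm (Γ₁ f) (Γ₀ f)] at h
    simp only [Complex.sub_im, Complex.conj_im] at h
    linarith
  constructor
  · intro h k
    obtain ⟨f, hf⟩ := surj (B k, k)
    obtain ⟨h₁, h₀⟩ := Prod.mk.inj hf
    have hf_im := h f (by rw [h₁, h₀])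
    rwa [key, h₁, h₀] at hf_im
  · intro h f hf
    rw [key, hf]
    exact h (Γ₀ f)
end

section
/- Let H and K be complex Hilbert spaces, D a linear subspace of H, and let T : D → H and Γ₁, Γ₀ : D → K be linear maps satisfying Green's formula ⟨Tf,g⟩_H − ⟨f,Tg⟩_H = ⟨Γ₁f,Γ₀g⟩_K − ⟨Γ₀f,Γ₁g⟩_K for all f,g ∈ D, and such that the map f ↦ (Γ₁f, Γ₀f) from D to K ⊕ K is surjective. Let B be a bounded linear operator on K and set D_B := {f ∈ D : Γ₁f = BΓ₀f}. Then ⟨Tf,g⟩ = ⟨f,Tg⟩ for all f,g ∈ D_B if and only if B is self-adjoint (B = B*). -/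
open scoped InnerProductSpace

/-- **Symmetry/self-adjointness criterion for almost solvable extensions.**
Given maps `T, Γ₁, Γ₀` on a subspace `D` of a complex Hilbert space `H` satisfying
Green's formula (inner products antilinear in the second argument: the paper's
`⟨x, y⟩` is Mathlib's `⟪y, x⟫_ℂ`) and the boundary-triple surjectivity condition,
and a bounded operator `B` on `K`, the restriction of `T` to
`{f ∈ D : Γ₁ f = B Γ₀ f}` is symmetric iff `B = B*`. -/
theorem symmetric_iff_boundary_param_selfAdjoint
    {H K : Type*}
    [NormedAddCommGroup H] [InnerProductSpace ℂ H] [CompleteSpace H]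
    [NormedAddCommGroup K] [InnerProductSpace ℂ K] [CompleteSpace K]
    (D : Submodule ℂ H) (T : D →ₗ[ℂ] H) (Γ₁ Γ₀ : D →ₗ[ℂ] K)
    (green : ∀ f g : D,
      ⟪(g : H), T f⟫_ℂ - ⟪T g, (f : H)⟫_ℂ = ⟪Γ₀ g, Γ₁ f⟫_ℂ - ⟪Γ₁ g, Γ₀ f⟫_ℂ)
    (surj : Function.Surjective (fun f : D => (Γ₁ f, Γ₀ f)))
    (B : K →L[ℂ] K) :
    (∀ f g : D, Γ₁ f = B (Γ₀ f) → Γ₁ g = B (Γ₀ g) →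
        ⟪(g : H), T f⟫_ℂ = ⟪T g, (f : H)⟫_ℂ) ↔
      ContinuousLinearMap.adjoint B = B := by
  constructor
  · intro h
    refine ((ContinuousLinearMap.eq_adjoint_iff B B).2 fun x y => ?_).symm
    obtain ⟨f, hf⟩ := surj (B y, y)
    obtain ⟨g, hg⟩ := surj (B x, x)
    obtain ⟨hf₁, hf₀⟩ := Prod.mk.inj hf
    obtain ⟨hg₁, hg₀⟩ := Prod.mk.inj hg
    have hfg := green f g
    rw [h f g (by rw [hf₁, hf₀]) (by rw [hg₁, hg₀]), sub_self, hf₁, hf₀, hg₁, hg₀] at hfg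
    exact (sub_eq_zero.1 hfg.symm).symm
  · intro hB f g hf hg
    rw [← sub_eq_zero, green, hf, hg, sub_eq_zero, ← ContinuousLinearMap.adjoint_inner_left, hB]
end

section
/- Let K be a complex Hilbert space, α a bounded self-adjoint operator on K, and M a bounded invertible operator on K such that M + (i/2)α² is also invertible. Define S := I − iα(M + (i/2)α²)⁻¹α. Then I + S is invertible and (I + S)⁻¹ = (1/2)(I + (i/2)αM⁻¹α). -/
/-- If `q (c a b) p = p - q`, then `1 + c b p a` is a right inverse of `1 - c b q a`. -/
theorem one_sub_smul_mul_one_add_smul {R A : Type*} [CommRing R] [Ring A] [Algebra R A]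
    (c : R) {a b p q : A} (h : q * (c • (a * b)) * p = p - q) :
    (1 - c • (b * q * a)) * (1 + c • (b * p * a)) = 1 := by
  have key : c • (b * q * a) * (c • (b * p * a)) = c • (b * p * a) - c • (b * q * a) := by
    calc c • (b * q * a) * (c • (b * p * a))
        = c • (b * (q * (c • (a * b)) * p) * a) := by
          simp only [smul_mul_assoc, mul_smul_comm, mul_assoc]
      _ = c • (b * p * a) - c • (b * q * a) := by
          rw [h, mul_sub, sub_mul, smul_sub]
  rw [sub_mul, mul_add, mul_add, key]
  simp

theorem one_add_smul_mul_one_sub_smul {R A : Type*} [CommRing R] [Ring A] [Algebra R A]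
    (c : R) {a b p q : A} (h : p * (c • (a * b)) * q = p - q) :
    (1 + c • (b * p * a)) * (1 - c • (b * q * a)) = 1 := by
  have h' : p * ((-c) • (a * b)) * q = q - p := by
    rw [neg_smul, mul_neg, neg_mul, h, neg_sub]
  simpa [sub_eq_add_neg] using one_sub_smul_mul_one_add_smul (-c) h'

/-- The second resolvent identity for `Ring.inverse`. -/
theorem Ring.inverse_mul_mul_inverse_of_isUnit_add {A : Type*} [Ring A] {m d : A}
    (hm : IsUnit m) (hmd : IsUnit (m + d)) :
    Ring.inverse (m + d) * d * Ring.inverse m = Ring.inverse m - Ring.inverse (m + d) := by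
  calc Ring.inverse (m + d) * d * Ring.inverse m
      = Ring.inverse (m + d) * (m + d) * Ring.inverse m
          - Ring.inverse (m + d) * (m * Ring.inverse m) := by noncomm_ring
    _ = Ring.inverse m - Ring.inverse (m + d) := by
      rw [Ring.inverse_mul_cancel _ hmd, Ring.mul_inverse_cancel _ hm, one_mul, mul_one]

theorem Ring.inverse_mul_mul_inverse_of_isUnit_add' {A : Type*} [Ring A] {m d : A}
    (hm : IsUnit m) (hmd : IsUnit (m + d)) :
    Ring.inverse m * d * Ring.inverse (m + d) = Ring.inverse m - Ring.inverse (m + d) := by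
  calc Ring.inverse m * d * Ring.inverse (m + d)
      = Ring.inverse m * ((m + d) * Ring.inverse (m + d))
          - Ring.inverse m * m * Ring.inverse (m + d) := by noncomm_ring
    _ = Ring.inverse m - Ring.inverse (m + d) := by
      rw [Ring.mul_inverse_cancel _ hmd, Ring.inverse_mul_cancel _ hm, one_mul, mul_one]

/-- **Inverse of `I + S` for the characteristic function `S = I − iα(M + (i/2)α²)⁻¹α`.**
Let `α` be a bounded self-adjoint operator and `M` a bounded invertible operator on a
complex Hilbert space `K` such that `M + (i/2)α²` is also invertible (all inverses are
bounded two-sided inverses, expressed via `Ring.inverse` in the ring of bounded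
operators). With `S := I − iα(M + (i/2)α²)⁻¹α`, the operator `I + S` is invertible and
`(I + S)⁻¹ = (1/2)(I + (i/2) α M⁻¹ α)`. -/
theorem inverse_of_one_add_characteristic_function
    {K : Type*} [NormedAddCommGroup K] [InnerProductSpace ℂ K] [CompleteSpace K]
    (α M : K →L[ℂ] K) (hα : IsSelfAdjoint α)
    (hM : IsUnit M) (hMα : IsUnit (M + (Complex.I / 2) • (α * α)))
    (S : K →L[ℂ] K)
    (hS : S = 1 - Complex.I • (α * Ring.inverse (M + (Complex.I / 2) • (α * α)) * α)) :
    IsUnit (1 + S) ∧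
      Ring.inverse (1 + S) =
        (2 : ℂ)⁻¹ • (1 + (Complex.I / 2) • (α * Ring.inverse M * α)) := by
 
  have hS' : 1 + S = (2 : ℂ) •
      (1 - (Complex.I / 2) • (α * Ring.inverse (M + (Complex.I / 2) • (α * α)) * α)) := by
    rw [hS, smul_sub, smul_smul, mul_div_cancel₀ _ (two_ne_zero' ℂ), two_smul]
    abel
  let u : (K →L[ℂ] K)ˣ :=
    { val := 1 + S
      inv := (2 : ℂ)⁻¹ • (1 + (Complex.I / 2) • (α * Ring.inverse M * α))
      val_inv := by
        rw [hS', smul_mul_smul_comm, mul_inv_cancel₀ (two_ne_zero' ℂ), one_smul]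
        exact one_sub_smul_mul_one_add_smul _
          (Ring.inverse_mul_mul_inverse_of_isUnit_add hM hMα)
      inv_val := by
        rw [hS', smul_mul_smul_comm, inv_mul_cancel₀ (two_ne_zero' ℂ), one_smul]
        exact one_add_smul_mul_one_sub_smul _
          (Ring.inverse_mul_mul_inverse_of_isUnit_add' hM hMα) }
  exact ⟨u.isUnit, Ring.inverse_unit u⟩
end

section
/- Let K be a complex Hilbert space, κ a bounded operator on K, and M a bounded operator on K such that M, M*, M + iI (hence M* − iI), M − κ, and M* − κ are all invertible. Set S := (M − iI)(M + iI)⁻¹ and χ⁺_κ := (I + iκ)/2, χ⁻_κ := (I − iκ)/2, and assume I + χ⁻_κ(S − I) and I + S* are invertible. Then (M + iI)⁻¹ · (I + χ⁻_κ(S − I))⁻¹(I + χ⁺_κ(S* − I))(I + S*)⁻¹(I + S) · (M + iI) = (M − κ)⁻¹(M* − κ)(M*)⁻¹M. -/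
open ContinuousLinearMap

/-- `(a r)⁻¹ = p a⁻¹` when `r` is a two-sided inverse of `p`. -/
theorem Ring.inverse_mul_eq_mul_inverse {R : Type*} [MonoidWithZero R] {a p r : R}
    (ha : IsUnit a) (hpr : p * r = 1) (hrp : r * p = 1) :
    Ring.inverse (a * r) = p * Ring.inverse a := by
  obtain ⟨u, rfl⟩ := ha
  have : (u : R) * r = ((u * ⟨r, p, hrp, hpr⟩ : Rˣ) : R) := rfl
  rw [this, Ring.inverse_unit, Ring.inverse_unit, mul_inv_rev]
  rfl

/-- **The scattering matrix in the spectral representation of `A₀`.**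
Let `κ, M` be bounded operators on a complex Hilbert space `K` such that `M`, `M*`,
`M + iI` (hence `M* − iI`), `M − κ` and `M* − κ` are invertible; let
`S := (M − iI)(M + iI)⁻¹`, `χ⁺ := (I + iκ)/2`, `χ⁻ := (I − iκ)/2`, and assume that
`I + χ⁻(S − I)` and `I + S*` are invertible (all inverses are bounded two-sided
inverses, taken via `Ring.inverse`). Then the model-space expression for the
scattering operator conjugated by `g ↦ (M + iI)⁻¹ g` equals
`(M − κ)⁻¹ (M* − κ) (M*)⁻¹ M`. -/
theorem scattering_matrix_formula
    {K : Type*} [NormedAddCommGroup K] [InnerProductSpace ℂ K] [CompleteSpace K]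
    (M κ : K →L[ℂ] K)
    (hM : IsUnit M) (hMs : IsUnit (adjoint M))
    (hMi : IsUnit (M + Complex.I • 1))
    (hMκ : IsUnit (M - κ)) (hMsκ : IsUnit (adjoint M - κ))
    (S χp χm : K →L[ℂ] K)
    (hS : S = (M - Complex.I • 1) * Ring.inverse (M + Complex.I • 1))
    (hχp : χp = (2 : ℂ)⁻¹ • (1 + Complex.I • κ))
    (hχm : χm = (2 : ℂ)⁻¹ • (1 - Complex.I • κ))
    (hW : IsUnit (1 + χm * (S - 1))) (hV : IsUnit (1 + adjoint S)) :
    Ring.inverse (M + Complex.I • 1) *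
        (Ring.inverse (1 + χm * (S - 1)) * (1 + χp * (adjoint S - 1)) *
          Ring.inverse (1 + adjoint S) * (1 + S)) *
        (M + Complex.I • 1) =
      Ring.inverse (M - κ) * (adjoint M - κ) * Ring.inverse (adjoint M) * M := by
  have hadj : adjoint (M + Complex.I • 1) = adjoint M - Complex.I • 1 := by
    simp [← star_eq_adjoint, sub_eq_add_neg]
  have hadj' : adjoint (M - Complex.I • 1) = adjoint M + Complex.I • 1 := by
    simp [← star_eq_adjoint, sub_eq_add_neg]
  have hMsi : IsUnit (adjoint M - Complex.I • 1) := by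
    rw [← hadj, ← star_eq_adjoint]
    exact hMi.star
  have hSs : adjoint S =
      Ring.inverse (adjoint M - Complex.I • 1) * (adjoint M + Complex.I • 1) := by
    rw [hS, ← hadj, ← hadj', ← star_eq_adjoint, ← star_eq_adjoint, ← star_eq_adjoint, star_mul,
      Ring.inverse_star]
  have hPR := Ring.mul_inverse_cancel _ hMi
  have hRP := Ring.inverse_mul_cancel _ hMi
  have hPQ := Ring.mul_inverse_cancel _ hMsi
  have hQP := Ring.inverse_mul_cancel _ hMsi
  set R := Ring.inverse (M + Complex.I • 1)
  set Q := Ring.inverse (adjoint M - Complex.I • 1)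
  have hS1 : S - 1 = (-(2 * Complex.I)) • R := by
    rw [hS]
    nth_rewrite 2 [← hPR]
    rw [← sub_mul, ← smul_one_mul (-(2 * Complex.I)) R]
    congr 1
    module
  have hSs1 : adjoint S - 1 = (2 * Complex.I) • Q := by
    rw [hSs]
    nth_rewrite 2 [← hQP]
    rw [← mul_sub, ← mul_smul_one (2 * Complex.I) Q]
    congr 1
    module
  have hW' : 1 + χm * (S - 1) = (M - κ) * R := by
    rw [hS1, hχm, mul_smul_comm, ← smul_mul_assoc]
    nth_rewrite 1 [← hPR]
    rw [← add_mul]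
    congr 1
    match_scalars <;> first | ring1 | linear_combination Complex.I_sq
  have hU' : 1 + χp * (adjoint S - 1) = (adjoint M - κ) * Q := by
    rw [hSs1, hχp, mul_smul_comm, ← smul_mul_assoc]
    nth_rewrite 1 [← hPQ]
    rw [← add_mul]
    congr 1
    match_scalars <;> first | ring1 | linear_combination Complex.I_sq
  have hV' : 1 + adjoint S = (2 : ℂ) • (adjoint M * Q) := by
    have hPQ' : adjoint M * Q - Complex.I • Q = 1 := by
      rw [← hPQ, sub_mul, smul_one_mul]
    rw [← sub_add_cancel (adjoint S) 1, hSs1, ← hPQ']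
    module
  have hS' : 1 + S = (2 : ℂ) • (M * R) := by
    have hPR' : M * R + Complex.I • R = 1 := by
      rw [← hPR, add_mul, smul_one_mul]
    rw [← sub_add_cancel S 1, hS1, ← hPR']
    module
  have h2 : Ring.inverse ((2 : ℂ) • (adjoint M * Q)) =
      (2 : ℂ)⁻¹ • ((adjoint M - Complex.I • 1) * Ring.inverse (adjoint M)) := by
    have hV2 := hV
    rw [hV'] at hV2
    apply hV2.mul_left_cancel
    rw [Ring.mul_inverse_cancel _ hV2, smul_mul_smul_comm, mul_inv_cancel₀ two_ne_zero, one_smul,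
      mul_assoc, ← mul_assoc Q, hQP, one_mul, Ring.mul_inverse_cancel _ hMs]
  rw [hW', hU', hV', hS', h2, Ring.inverse_mul_eq_mul_inverse hMκ hPR hRP]
  simp only [mul_smul_comm, smul_mul_assoc, smul_smul]
  rw [mul_inv_cancel₀ two_ne_zero, one_smul]
  simp only [mul_assoc, hRP, mul_one]
  rw [← mul_assoc R, hRP, one_mul, ← mul_assoc Q, hQP, one_mul]
end

section
/- Let K be a complex Hilbert space, s > 0, P_e an orthogonal projection on K (P_e = P_e* = P_e²), κ a bounded self-adjoint operator on K, and M a bounded operator on K with M − M* = 2i√s·P_e and with M − κ (hence M* − κ = (M − κ)*) invertible. Then for all u, v in the range of P_e: ⟨P_e(M − κ)⁻¹(M* − κ)u, P_e(M − κ)⁻¹(M* − κ)v⟩ = ⟨u, v⟩. -/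
open ContinuousLinearMap
open scoped InnerProductSpace

/-- If `A - A† = c • P` with `P` an orthogonal projection and `c ≠ 0`, then `A x = A† u` and
`A y = A† v` force `⟪P x, P y⟫ = ⟪P u, P v⟫`. -/
theorem inner_projection_eq_of_apply_eq_adjoint_apply
    {K : Type*} [NormedAddCommGroup K] [InnerProductSpace ℂ K] [CompleteSpace K]
    {A P : K →L[ℂ] K} {c : ℂ} (hc : c ≠ 0)
    (hPsa : IsSelfAdjoint P) (hP2 : P * P = P) (hA : A - adjoint A = c • P)
    {x y u v : K} (hx : A x = adjoint A u) (hy : A y = adjoint A v) :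
    ⟪P x, P y⟫_ℂ = ⟪P u, P v⟫_ℂ := by
  have key (a b : K) : c * ⟪P a, P b⟫_ℂ = ⟪a, A b⟫_ℂ - ⟪a, adjoint A b⟫_ℂ := by
    have hb : A b - adjoint A b = c • P b := congrArg (fun T : K →L[ℂ] K => T b) hA
    have hPb : P (P b) = P b := congrArg (fun T : K →L[ℂ] K => T b) hP2
    rw [← inner_sub_right, hb, inner_smul_right, ← adjoint_inner_right P,
      hPsa.adjoint_eq, hPb]
  apply mul_left_cancel₀ hc
  calc c * ⟪P x, P y⟫_ℂ
      = ⟪adjoint A u, v⟫_ℂ - ⟪adjoint A u, y⟫_ℂ := by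
        rw [key, hy, adjoint_inner_right, adjoint_inner_right, hx]
    _ = c * ⟪P u, P v⟫_ℂ := by
        rw [key, adjoint_inner_left, adjoint_inner_left, hy]

/-- **`Σ̂ᵉκ` is an isometry on `P_e K`.**
Let `P` be an orthogonal projection on a complex Hilbert space `K`, `κ` a bounded
self-adjoint operator, `s > 0`, and `M` a bounded operator with
`M − M* = 2i√s·P` and `M − κ` invertible (inverses are bounded two-sided inverses,
taken via `Ring.inverse`; the inner product, antilinear in the second argument in
the paper, is here Mathlib's inner product). Then `u ↦ P (M − κ)⁻¹ (M* − κ) u`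
preserves inner products of vectors in the range of `P`. -/
theorem scattering_matrix_isometric_on_external_subspace
    {K : Type*} [NormedAddCommGroup K] [InnerProductSpace ℂ K] [CompleteSpace K]
    (s : ℝ) (hs : 0 < s)
    (P κ M : K →L[ℂ] K)
    (hPsa : IsSelfAdjoint P) (hP2 : P * P = P)
    (hκ : IsSelfAdjoint κ)
    (hIm : M - adjoint M = ((2 : ℂ) * (Real.sqrt s : ℂ) * Complex.I) • P)
    (hMκ : IsUnit (M - κ)) :
    ∀ u v : K, u ∈ Set.range P → v ∈ Set.range P →
      ⟪P (Ring.inverse (M - κ) ((adjoint M - κ) u)),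
          P (Ring.inverse (M - κ) ((adjoint M - κ) v))⟫_ℂ = ⟪u, v⟫_ℂ := by
  have hadj : adjoint (M - κ) = adjoint M - κ := by rw [map_sub, hκ.adjoint_eq]
  have hc : (2 : ℂ) * (Real.sqrt s : ℂ) * Complex.I ≠ 0 := by
    have : (Real.sqrt s : ℂ) ≠ 0 := by exact_mod_cast (Real.sqrt_pos.mpr hs).ne'
    simp [this]
  have hdiff : (M - κ) - adjoint (M - κ) = ((2 : ℂ) * (Real.sqrt s : ℂ) * Complex.I) • P := by
    rw [hadj, sub_sub_sub_cancel_right, hIm]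
  have hinv (w : K) : (M - κ) (Ring.inverse (M - κ) w) = w :=
    congrArg (fun T : K →L[ℂ] K => T w) (Ring.mul_inverse_cancel _ hMκ)
  have hfix (w : K) : P (P w) = P w := congrArg (fun T : K →L[ℂ] K => T w) hP2
  rintro _ _ ⟨a, rfl⟩ ⟨b, rfl⟩
  rw [← hadj, inner_projection_eq_of_apply_eq_adjoint_apply hc hPsa hP2 hdiff
    (hinv _) (hinv _), hfix, hfix]
end

section
/- Let K be a complex Hilbert space, s > 0, P_e a bounded idempotent operator on K (P_e² = P_e), κ a bounded operator on K, and M a bounded operator on K with M − M* = 2i√s·P_e and with M − κ and M* invertible. Then P_e(M − κ)⁻¹(M* − κ)(M*)⁻¹M P_e = (P_e(M − κ)⁻¹(M* − κ)P_e)·(P_e(M*)⁻¹M P_e). -/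
open ContinuousLinearMap

/-- **Factorisation of the external scattering matrix.**
Let `P` be a bounded idempotent operator on a complex Hilbert space `K`, `κ, M`
bounded operators, `s > 0`, with `M − M* = 2i√s·P` and `M − κ` and `M*` invertible
(inverses are bounded two-sided inverses, taken via `Ring.inverse`). Then
`P(M − κ)⁻¹(M* − κ)(M*)⁻¹M P = (P(M − κ)⁻¹(M* − κ)P)·(P(M*)⁻¹M P)`. -/
theorem external_scattering_matrix_factorisation
    {K : Type*} [NormedAddCommGroup K] [InnerProductSpace ℂ K] [CompleteSpace K]
    (s : ℝ) (hs : 0 < s)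
    (P κ M : K →L[ℂ] K) (hP2 : P * P = P)
    (hIm : M - adjoint M = ((2 : ℂ) * (Real.sqrt s : ℂ) * Complex.I) • P)
    (hMκ : IsUnit (M - κ)) (hMs : IsUnit (adjoint M)) :
    P * Ring.inverse (M - κ) * (adjoint M - κ) * Ring.inverse (adjoint M) * M * P =
      (P * Ring.inverse (M - κ) * (adjoint M - κ) * P) *
        (P * Ring.inverse (adjoint M) * M * P) := by
  have hA : Ring.inverse (M - κ) * (adjoint M - κ) =
      1 - ((2 : ℂ) * (Real.sqrt s : ℂ) * Complex.I) • (Ring.inverse (M - κ) * P) := by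
    have h : adjoint M - κ =
        (M - κ) - ((2 : ℂ) * (Real.sqrt s : ℂ) * Complex.I) • P := by
      rw [← hIm]; abel
    rw [h, mul_sub, Ring.inverse_mul_cancel _ hMκ, mul_smul_comm]
  have hPA : P * Ring.inverse (M - κ) * (adjoint M - κ) * P =
      P * Ring.inverse (M - κ) * (adjoint M - κ) := by
    rw [mul_assoc P, hA, mul_assoc, sub_mul, one_mul, smul_mul_assoc, mul_assoc _ P P, hP2,
      mul_sub, mul_sub, hP2, mul_one]
  calc
    _ = P * Ring.inverse (M - κ) * (adjoint M - κ) * (Ring.inverse (adjoint M) * M * P) := by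
      simp only [mul_assoc]
    _ = P * Ring.inverse (M - κ) * (adjoint M - κ) * P *
        (Ring.inverse (adjoint M) * M * P) := by rw [hPA]
    _ = P * Ring.inverse (M - κ) * (adjoint M - κ) * (P * P) *
        (Ring.inverse (adjoint M) * M * P) := by rw [hP2]
    _ = _ := by simp only [mul_assoc]
end

section
/- Let K be a complex Hilbert space, s > 0, P_e a bounded idempotent operator on K (P_e² = P_e), κ and M⁽ⁱ⁾ bounded operators on K, and set M := M⁽ⁱ⁾ + i√s·P_e. If M − κ and M⁽ⁱ⁾ − κ are invertible, then P_e(M − κ)⁻¹P_e = (P_e − i√s·P_e(M − κ)⁻¹P_e)·(P_e(M⁽ⁱ⁾ − κ)⁻¹P_e). -/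
/-- **Second-resolvent-identity step of the inverse scattering procedure.**
Let `P` be a bounded idempotent operator on a complex Hilbert space `K`, `κ` and
`M⁽ⁱ⁾` bounded operators, `s > 0`, and `M := M⁽ⁱ⁾ + i√s·P`. If `M − κ` and
`M⁽ⁱ⁾ − κ` are invertible (bounded two-sided inverses, taken via `Ring.inverse`),
then `P(M − κ)⁻¹P = (P − i√s·P(M − κ)⁻¹P)·(P(M⁽ⁱ⁾ − κ)⁻¹P)`. -/
theorem resolvent_identity_external_projection
    {K : Type*} [NormedAddCommGroup K] [InnerProductSpace ℂ K] [CompleteSpace K]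
    (s : ℝ) (hs : 0 < s)
    (P κ Mi M : K →L[ℂ] K) (hP2 : P * P = P)
    (hM : M = Mi + ((Real.sqrt s : ℂ) * Complex.I) • P)
    (hMκ : IsUnit (M - κ)) (hMiκ : IsUnit (Mi - κ)) :
    P * Ring.inverse (M - κ) * P =
      (P - ((Real.sqrt s : ℂ) * Complex.I) • (P * Ring.inverse (M - κ) * P)) *
        (P * Ring.inverse (Mi - κ) * P) := by
  have hsub : Mi - κ - (M - κ) = -(((Real.sqrt s : ℂ) * Complex.I) • P) := by
    rw [hM]; abel
  have hres := Ring.inverse_sub_inverse (iff_of_true hMκ hMiκ)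
  rw [hsub, sub_eq_iff_eq_add] at hres
  generalize Ring.inverse (M - κ) = A at hres ⊢
  generalize Ring.inverse (Mi - κ) = B at hres ⊢
  generalize (Real.sqrt s : ℂ) * Complex.I = c at hres ⊢
  have hP (X : K →L[ℂ] K) : P * (P * X) = P * X := by rw [← mul_assoc, hP2]
  calc P * A * P = P * (A * -(c • P) * B + B) * P := by rw [← hres]
    _ = (P - c • (P * A * P)) * (P * B * P) := by
      simp only [mul_add, add_mul, mul_neg, neg_mul, sub_mul, mul_smul_comm, smul_mul_assoc,
        mul_assoc, hP]
      abel
end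

section
/- Let K be a complex Hilbert space, s > 0, P_e an orthogonal projection on K (P_e = P_e* = P_e²), M⁽ⁱ⁾ a bounded self-adjoint operator on K, κ a bounded self-adjoint operator on K, and set M := M⁽ⁱ⁾ + i√s·P_e. Assume M − κ and M* − κ are invertible. If u ∈ K satisfies (M* − κ)⁻¹u = −(M − κ)⁻¹u, then (M⁽ⁱ⁾ − κ)((M − κ)⁻¹u) = 0. In particular, if M⁽ⁱ⁾ − κ is injective, then u = 0. -/
open ContinuousLinearMap

/-- The sum of `A + c • P` and its adjoint is `2 • A` when `A` and `P` are self-adjoint and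
`c` is purely imaginary. -/
theorem add_smul_add_adjoint_eq_two_smul
    {K : Type*} [NormedAddCommGroup K] [InnerProductSpace ℂ K] [CompleteSpace K]
    {A P : K →L[ℂ] K} (hA : IsSelfAdjoint A) (hP : IsSelfAdjoint P)
    {c : ℂ} (hc : star c = -c) :
    (A + c • P) + adjoint (A + c • P) = (2 : ℂ) • A := by
  rw [← star_eq_adjoint, star_add, star_smul, hA.star_eq, hP.star_eq, hc]
  module

/-- Applying an invertible operator after its `Ring.inverse` gives back the vector. -/
theorem apply_ringInverse_apply
    {K : Type*} [NormedAddCommGroup K] [InnerProductSpace ℂ K]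
    {T : K →L[ℂ] K} (hT : IsUnit T) (u : K) : T (Ring.inverse T u) = u :=
  DFunLike.congr_fun (Ring.mul_inverse_cancel T hT) u

/-- **`−1` is not an eigenvalue of `Σ̂ᵉκ`.**
Let `P` be an orthogonal projection on a complex Hilbert space `K`, `M⁽ⁱ⁾` and `κ`
bounded self-adjoint operators, `s > 0`, and `M := M⁽ⁱ⁾ + i√s·P` (so
`M* = M⁽ⁱ⁾ − i√s·P`); assume `M − κ` and `M* − κ` are invertible (bounded two-sided
inverses, taken via `Ring.inverse`). If `u ∈ K` satisfies
`(M* − κ)⁻¹ u = −(M − κ)⁻¹ u`, then `(M⁽ⁱ⁾ − κ)((M − κ)⁻¹ u) = 0`; in particular,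
if `M⁽ⁱ⁾ − κ` is injective then `u = 0`. -/
theorem no_eigenvalue_minus_one
    {K : Type*} [NormedAddCommGroup K] [InnerProductSpace ℂ K] [CompleteSpace K]
    (s : ℝ) (hs : 0 < s)
    (P Mi κ M : K →L[ℂ] K)
    (hPsa : IsSelfAdjoint P) (hP2 : P * P = P)
    (hMi : IsSelfAdjoint Mi) (hκ : IsSelfAdjoint κ)
    (hM : M = Mi + ((Real.sqrt s : ℂ) * Complex.I) • P)
    (hMκ : IsUnit (M - κ)) (hMsκ : IsUnit (adjoint M - κ)) :
    ∀ u : K, Ring.inverse (adjoint M - κ) u = -(Ring.inverse (M - κ) u) →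
      (Mi - κ) (Ring.inverse (M - κ) u) = 0 ∧
        (Function.Injective (Mi - κ) → u = 0) := by
  intro u hu
  have hc : star ((Real.sqrt s : ℂ) * Complex.I) = -((Real.sqrt s : ℂ) * Complex.I) := by
    simp
  have hadd : M + adjoint M = (2 : ℂ) • Mi := by
    rw [hM]
    exact add_smul_add_adjoint_eq_two_smul hMi hPsa hc
  have h₁ := apply_ringInverse_apply hMκ u
  have h₂ := apply_ringInverse_apply hMsκ u
  rw [hu, map_neg] at h₂
  set v := Ring.inverse (M - κ) u
  have hv : (2 : ℂ) • (Mi - κ) v = 0 := by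
    have hsum : (2 : ℂ) • (Mi - κ) = (M - κ) + (adjoint M - κ) := by
      rw [smul_sub, ← hadd]
      module
    rw [← smul_apply, hsum, add_apply, h₁, ← h₂, neg_add_cancel]
  have hker : (Mi - κ) v = 0 := (smul_eq_zero.mp hv).resolve_left two_ne_zero
  refine ⟨hker, fun hinj => ?_⟩
  have hv0 : v = 0 := hinj (hker.trans (map_zero _).symm)
  rw [← h₁, hv0, map_zero]
end

section
/- Let H be a complex separable Hilbert space and A a closed, densely defined symmetric linear operator on H with equal deficiency indices, with adjoint A*. Let K be a complex separable Hilbert space and Γ₁, Γ₀ : dom(A*) → K linear maps such that ⟨A*f,g⟩ − ⟨f,A*g⟩ = ⟨Γ₁f,Γ₀g⟩ − ⟨Γ₀f,Γ₁g⟩ for all f,g ∈ dom(A*) and such that f ↦ (Γ₁f, Γ₀f) maps dom(A*) onto K ⊕ K. For a bounded operator B on K, let A_B denote the restriction of A* to {f ∈ dom(A*) : Γ₁f = BΓ₀f}. Then A_B is densely defined and (A_B)* = A_{B*}, i.e. the Hilbert-space adjoint of A_B is the restriction of A* to {f ∈ dom(A*) : Γ₁f = B*Γ₀f}. -/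
open scoped InnerProductSpace

namespace LinearPMap

theorem mem_domain_domRestrict_map_ker {R E F K : Type*} [Ring R] [AddCommGroup E] [Module R E]
    [AddCommGroup F] [Module R F] [AddCommGroup K] [Module R K] (T : E →ₗ.[R] F)
    (φ : T.domain →ₗ[R] K) {x : E} :
    x ∈ (T.domRestrict (Submodule.map T.domain.subtype (LinearMap.ker φ))).domain ↔
      ∃ hx : x ∈ T.domain, φ ⟨x, hx⟩ = 0 := by
  rw [domRestrict_domain]
  constructor
  · rintro ⟨⟨y, hy, rfl⟩, -⟩
    exact ⟨y.2, hy⟩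
  · rintro ⟨hx, h⟩
    exact ⟨⟨⟨x, hx⟩, h, rfl⟩, hx⟩

variable {𝕜 E F K : Type*} [RCLike 𝕜] [NormedAddCommGroup E] [InnerProductSpace 𝕜 E]
  [NormedAddCommGroup F] [InnerProductSpace 𝕜 F] [CompleteSpace E]

/-- Taking adjoints reverses inclusions of densely defined operators. -/
theorem adjoint_le_adjoint_of_le {S T : E →ₗ.[𝕜] F} (hS : Dense (S.domain : Set E)) (h : S ≤ T) :
    T.adjoint ≤ S.adjoint := by
  have hT : Dense (T.domain : Set E) := hS.mono h.1
  refine IsFormalAdjoint.le_adjoint hS fun x y => ?_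
  rw [h.2 (y := ⟨x, h.1 x.2⟩) rfl]
  exact (adjoint_isFormalAdjoint hT).symm ⟨x, h.1 x.2⟩ y

end LinearPMap

/-- The boundary form of a jointly surjective pair of boundary maps is nondegenerate. -/
theorem eq_zero_of_forall_inner_eq_inner {𝕜 V K : Type*} [RCLike 𝕜]
    [NormedAddCommGroup K] [InnerProductSpace 𝕜 K] {Γ₁ Γ₀ : V → K}
    (surj : Function.Surjective fun f => (Γ₁ f, Γ₀ f)) {a b : K}
    (h : ∀ g, ⟪Γ₀ g, a⟫_𝕜 = ⟪Γ₁ g, b⟫_𝕜) : a = 0 ∧ b = 0 := by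
  constructor
  · obtain ⟨g, hg⟩ := surj (0, a)
    obtain ⟨h₁, h₀⟩ := Prod.mk.inj hg
    simpa [h₁, h₀] using h g
  · obtain ⟨g, hg⟩ := surj (b, 0)
    obtain ⟨h₁, h₀⟩ := Prod.mk.inj hg
    simpa [h₁, h₀] using (h g).symm

/-- **Adjoints of almost solvable extensions: `(A_B)* = A_{B*}`.**
Let `A` be a closed, densely defined symmetric operator (a `LinearPMap`) on a complex
separable Hilbert space `H` with equal deficiency indices, and let `(K, Γ₁, Γ₀)` be a
boundary triple for `A*`: the maps `Γ₁, Γ₀ : dom A* → K` satisfy Green's formula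
(inner products antilinear in the second argument: the paper's `⟨x, y⟩` is Mathlib's
`⟪y, x⟫_ℂ`) and `f ↦ (Γ₁ f, Γ₀ f)` is surjective onto `K ⊕ K`. For a bounded operator
`B` on `K`, let `A_B` be the restriction of `A*` to `{f ∈ dom A* : Γ₁ f = B Γ₀ f}`.
Then `A_B` is densely defined and `(A_B)* = A_{B*}`. -/
theorem adjoint_of_almost_solvable_extension
    {H K : Type*}
    [NormedAddCommGroup H] [InnerProductSpace ℂ H] [CompleteSpace H]
    [TopologicalSpace.SeparableSpace H]
    [NormedAddCommGroup K] [InnerProductSpace ℂ K] [CompleteSpace K]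
    [TopologicalSpace.SeparableSpace K]
    (A : H →ₗ.[ℂ] H)
    (hdense : Dense (A.domain : Set H))
    (hclosed : A.IsClosed)
    (hsym : ∀ f g : A.domain, ⟪A f, (g : H)⟫_ℂ = ⟪(f : H), A g⟫_ℂ)
    (hdef : Module.rank ℂ
        (LinearMap.ker (A.adjoint.toFun - Complex.I • A.adjoint.domain.subtype)) =
      Module.rank ℂ
        (LinearMap.ker (A.adjoint.toFun + Complex.I • A.adjoint.domain.subtype)))
    (Γ₁ Γ₀ : A.adjoint.domain →ₗ[ℂ] K)
    (green : ∀ f g : A.adjoint.domain,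
      ⟪(g : H), A.adjoint f⟫_ℂ - ⟪A.adjoint g, (f : H)⟫_ℂ =
        ⟪Γ₀ g, Γ₁ f⟫_ℂ - ⟪Γ₁ g, Γ₀ f⟫_ℂ)
    (surj : Function.Surjective (fun f : A.adjoint.domain => (Γ₁ f, Γ₀ f)))
    (B : K →L[ℂ] K) :
    Dense ((A.adjoint.domRestrict (Submodule.map A.adjoint.domain.subtype
        (LinearMap.ker (Γ₁ - B.toLinearMap ∘ₗ Γ₀)))).domain : Set H) ∧
    (A.adjoint.domRestrict (Submodule.map A.adjoint.domain.subtype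
        (LinearMap.ker (Γ₁ - B.toLinearMap ∘ₗ Γ₀)))).adjoint =
      A.adjoint.domRestrict (Submodule.map A.adjoint.domain.subtype
        (LinearMap.ker (Γ₁ - (ContinuousLinearMap.adjoint B).toLinearMap ∘ₗ Γ₀))) := by
  have le_adj : A ≤ A.adjoint := LinearPMap.IsFormalAdjoint.le_adjoint hdense hsym
  have le_ext (C : K →L[ℂ] K) : A ≤ A.adjoint.domRestrict (Submodule.map A.adjoint.domain.subtype
      (LinearMap.ker (Γ₁ - C.toLinearMap ∘ₗ Γ₀))) := by
    refine ⟨fun x hx => ?_, fun x y hxy => ?_⟩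
    · rw [LinearPMap.mem_domain_domRestrict_map_ker]
      have hx' := le_adj.1 hx
      obtain ⟨h₁, h₀⟩ := eq_zero_of_forall_inner_eq_inner (𝕜 := ℂ) surj
        (a := Γ₁ ⟨x, hx'⟩) (b := Γ₀ ⟨x, hx'⟩) fun g => by
          rw [← sub_eq_zero, ← green, ← le_adj.2 (x := ⟨x, hx⟩) rfl, sub_eq_zero]
          exact (LinearPMap.adjoint_isFormalAdjoint hdense g ⟨x, hx⟩).symm
      exact ⟨hx', by simp [h₁, h₀]⟩
    · rw [le_adj.2 (x := x) (y := ⟨x, le_adj.1 x.2⟩) rfl]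
      exact (LinearPMap.domRestrict_le.2 hxy.symm).symm
  have dense_ext := hdense.mono (le_ext B).1
  refine ⟨dense_ext, le_antisymm ?_ ?_⟩
  · have le := LinearPMap.adjoint_le_adjoint_of_le hdense (le_ext B)
    refine ⟨fun y hy => ?_, fun y z hyz => ?_⟩
    · rw [LinearPMap.mem_domain_domRestrict_map_ker]
      refine ⟨le.1 hy, ext_inner_right ℂ fun k => ?_⟩
      obtain ⟨f, hf⟩ := surj (B k, k)
      obtain ⟨h₁, h₀⟩ := Prod.mk.inj hf
      have hfB := (A.adjoint.mem_domain_domRestrict_map_ker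
        (Γ₁ - B.toLinearMap ∘ₗ Γ₀)).2 ⟨f.2, by simp [h₁, h₀]⟩
      have key := LinearPMap.adjoint_isFormalAdjoint dense_ext ⟨y, hy⟩ ⟨f, hfB⟩
      rw [le.2 (y := ⟨y, le.1 hy⟩) rfl, LinearPMap.domRestrict_le.2 (y := f) rfl] at key
      have hg := green f ⟨y, le.1 hy⟩
      rw [h₁, h₀, sub_eq_zero.2 key.symm, eq_comm, sub_eq_zero] at hg
      simp [inner_sub_left, ContinuousLinearMap.adjoint_inner_left, hg]
    · rw [le.2 (x := y) (y := ⟨y, le.1 y.2⟩) rfl]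
      exact (LinearPMap.domRestrict_le.2 hyz.symm).symm
  · refine LinearPMap.IsFormalAdjoint.le_adjoint dense_ext fun f g => ?_
    obtain ⟨hf, hfB⟩ := (LinearPMap.mem_domain_domRestrict_map_ker _ _).1 f.2
    obtain ⟨hg, hgB⟩ := (LinearPMap.mem_domain_domRestrict_map_ker _ _).1 g.2
    rw [LinearPMap.domRestrict_le.2 (x := f) (y := ⟨f, hf⟩) rfl,
      LinearPMap.domRestrict_le.2 (x := g) (y := ⟨g, hg⟩) rfl, eq_comm, ← sub_eq_zero]
    simp only [LinearMap.sub_apply, LinearMap.comp_apply, sub_eq_zero] at hfB hgB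
    refine (green ⟨g, hg⟩ ⟨f, hf⟩).trans ?_
    rw [hfB, hgB]
    simp [ContinuousLinearMap.adjoint_inner_right]
end
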